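/- Let a > 0, b ∈ ℝ and 0 < ε < π. Then there is no entire function f of exponential type that is frequently hypercyclic for T₁ on H(ℂ) and whose indicator function satisfies h_f(θ) = −b·sin(θ) + a·|sin(θ+ε)| for all θ ∈ [−π, π]. -/

import Mathlib

open Filter Complex

/-- Support function `H_K(z) = sup { Re (z·u) : u ∈ K }` of a set `K ⊆ ℂ`. -/
noncomputable def suppFn (K : Set ℂ) (z : ℂ) : ℝ :=
  sSup ((fun u => (z * u).re) '' K)

/-- The norm `‖f‖_{K,n} = sup_z |f z| · exp (−H_K z − |z|/n)`. -/
noncomputable def expNorm (K : Set ℂ) (n : ℕ) (f : ℂ → ℂ) : ℝ :=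
  sSup (Set.range fun z : ℂ => ‖f z‖ * Real.exp (-(suppFn K z) - ‖z‖ / n))

/-- Membership in `Exp(K)`: `f` is entire and all the norms `‖f‖_{K,n}` are finite. -/
def MemExp (K : Set ℂ) (f : ℂ → ℂ) : Prop :=
  Differentiable ℂ f ∧ ∀ n : ℕ, 0 < n →
    BddAbove (Set.range fun z : ℂ => ‖f z‖ * Real.exp (-(suppFn K z) - ‖z‖ / n))

open scoped Classical in
/-- Lower density of a set of natural numbers. -/
noncomputable def lowerDensity (A : Set ℕ) : ℝ :=
  liminf (fun N : ℕ =>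
    (((Finset.range (N + 1)).filter (fun n => n ∈ A)).card : ℝ) / N) atTop

/-- Lower density of a discrete subset of `ℂ`. -/
noncomputable def ldensC (Λ : Set ℂ) : ℝ :=
  liminf (fun r : ℝ => (Nat.card {z : ℂ // z ∈ Λ ∧ ‖z‖ ≤ r} : ℝ) / r) atTop

/-- `f` is hypercyclic for the translation `T₁` on `Exp(K)`. -/
def HCExp (K : Set ℂ) (f : ℂ → ℂ) : Prop :=
  MemExp K f ∧ ∀ g : ℂ → ℂ, MemExp K g → ∀ n : ℕ, 0 < n → ∀ ε > (0 : ℝ),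
    ∃ k : ℕ, expNorm K n (fun z => f (z + (k : ℂ)) - g z) < ε

/-- `f` is frequently hypercyclic for the translation `T₁` on `Exp(K)`. -/
def FHCExp (K : Set ℂ) (f : ℂ → ℂ) : Prop :=
  MemExp K f ∧ ∀ g : ℂ → ℂ, MemExp K g → ∀ n : ℕ, 0 < n → ∀ ε > (0 : ℝ),
    0 < lowerDensity {k : ℕ | expNorm K n (fun z => f (z + (k : ℂ)) - g z) < ε}

/-- `f` is hypercyclic (Birkhoff-universal) for `T₁` on `H(ℂ)`. -/
def HCEnt (f : ℂ → ℂ) : Prop :=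
  Differentiable ℂ f ∧ ∀ g : ℂ → ℂ, Differentiable ℂ g → ∀ R > (0 : ℝ), ∀ ε > (0 : ℝ),
    ∃ k : ℕ, ∀ z : ℂ, ‖z‖ ≤ R → ‖f (z + (k : ℂ)) - g z‖ < ε

/-- `f` is frequently hypercyclic (frequently Birkhoff-universal) for `T₁` on `H(ℂ)`. -/
def FHCEnt (f : ℂ → ℂ) : Prop :=
  Differentiable ℂ f ∧ ∀ g : ℂ → ℂ, Differentiable ℂ g → ∀ R > (0 : ℝ), ∀ ε > (0 : ℝ),
    0 < lowerDensity {k : ℕ | ∀ z : ℂ, ‖z‖ ≤ R → ‖f (z + (k : ℂ)) - g z‖ < ε}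

/-- `f` is an entire function of (finite) exponential type. -/
def ExpType (f : ℂ → ℂ) : Prop :=
  Differentiable ℂ f ∧ ∃ C τ : ℝ, ∀ z : ℂ, ‖f z‖ ≤ C * Real.exp (τ * ‖z‖)

/-- The indicator function `h_f(θ) = limsup_{r→∞} log |f(r e^{iθ})| / r`. -/
noncomputable def indicatorFn (f : ℂ → ℂ) (θ : ℝ) : ℝ :=
  limsup (fun r : ℝ => Real.log ‖f ((r : ℂ) * Complex.exp (θ * Complex.I))‖ / r) atTop

open Metric in
/-- Removing one zero by a Blaschke factor. -/
lemma blaschke_bound (S : Finset ℂ) : ∀ (g : ℂ → ℂ), Differentiable ℂ g → ∀ (C q : ℝ), 0 ≤ q →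
    (∀ u : ℂ, ‖u‖ = 1 → ‖g u‖ ≤ C) → (∀ s ∈ S, g s = 0) → (∀ s ∈ S, ‖s‖ < 1) →
    ∀ p : ℂ, ‖p‖ < 1 → (∀ s ∈ S, ‖p - s‖ ≤ q * ‖1 - (starRingEnd ℂ) s * p‖) →
    ‖g p‖ ≤ C * q ^ S.card := by
  classical
  induction S using Finset.induction_on with
  | empty =>
    intro g hg C q hq hC _ _ p hp _
    simp only [Finset.card_empty, pow_zero, mul_one]
    refine Complex.norm_le_of_forall_mem_frontier_norm_le (U := ball (0:ℂ) 1) isBounded_ball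
      hg.diffContOnCl ?_ ?_
    · intro z hz
      rw [frontier_ball _ one_ne_zero] at hz
      exact hC z (by simpa using hz)
    · exact subset_closure (by simpa using hp)
  | insert s S hs ih =>
    intro g hg C q hq hC h0 h1 p hp hB
    have hgs : g s = 0 := h0 s (by simp)
    have hs1 : ‖s‖ < 1 := h1 s (by simp)
    have hd : Differentiable ℂ (dslope g s) := by
      rw [← differentiableOn_univ] at hg ⊢
      exact (Complex.differentiableOn_dslope (by simp)).2 hg
    have hfac : ∀ z, g z = (z - s) * dslope g s z := by
      intro z
      have := sub_smul_dslope g s z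
      simp only [smul_eq_mul, hgs, sub_zero] at this
      exact this.symm
    have key := ih (fun z => (1 - (starRingEnd ℂ) s * z) * dslope g s z) (by fun_prop) C q hq ?_ ?_
      (fun t ht => h1 t (by simp [ht])) p hp (fun t ht => hB t (by simp [ht]))
    · rw [Finset.card_insert_of_notMem hs, hfac p, norm_mul, pow_succ]
      calc ‖p - s‖ * ‖dslope g s p‖ ≤ q * ‖1 - (starRingEnd ℂ) s * p‖ * ‖dslope g s p‖ := by
            gcongr; exact hB s (by simp)
        _ = q * ‖(1 - (starRingEnd ℂ) s * p) * dslope g s p‖ := by rw [norm_mul]; ring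
        _ ≤ q * (C * q ^ S.card) := by gcongr
        _ = _ := by ring
    · intro u hu
      have h2 : ‖1 - (starRingEnd ℂ) s * u‖ = ‖u - s‖ := by
        have : (1 - (starRingEnd ℂ) s * u) = u * (starRingEnd ℂ) (u - s) := by
          have huu : u * (starRingEnd ℂ) u = 1 := by
            rw [Complex.mul_conj, Complex.normSq_eq_norm_sq, hu]; simp
          rw [map_sub, mul_sub, huu]; ring
        rw [this, norm_mul, hu, one_mul, Complex.norm_conj]
      rw [norm_mul, h2, ← norm_mul, ← hfac]
      exact hC u hu
    · intro t ht
      have hts : t ≠ s := by rintro rfl; exact hs ht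
      have := hfac t
      rw [h0 t (by simp [ht])] at this
      have : dslope g s t = 0 := by
        rcases mul_eq_zero.1 this.symm with h | h
        · exact absurd (sub_eq_zero.1 h) hts
        · exact h
      simp [this]

lemma pseudo_bound (σ : ℝ) (hσ0 : 0 ≤ σ) (hσ : σ < 1) :
    ∃ q : ℝ, 0 < q ∧ q < 1 ∧ ∀ p s : ℂ, ‖p‖ ^ 2 ≤ σ → ‖s‖ ^ 2 ≤ σ →
      ‖p - s‖ ≤ q * ‖1 - (starRingEnd ℂ) s * p‖ := by
  have hQ : 0 < 1 - (1 - σ) ^ 2 / 4 := by nlinarith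
  refine ⟨Real.sqrt (1 - (1 - σ) ^ 2 / 4), Real.sqrt_pos.2 hQ, ?_, ?_⟩
  · rw [Real.sqrt_lt' one_pos]; nlinarith
  · intro p s hp hs
    have hid : ‖1 - (starRingEnd ℂ) s * p‖ ^ 2 - ‖p - s‖ ^ 2 = (1 - ‖p‖ ^ 2) * (1 - ‖s‖ ^ 2) := by
      simp only [← Complex.normSq_eq_norm_sq, Complex.normSq_apply]
      simp
      ring
    have hp1 : ‖p‖ ≤ 1 := by nlinarith [norm_nonneg p]
    have hs1 : ‖s‖ ≤ 1 := by nlinarith [norm_nonneg s]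
    have hle : ‖1 - (starRingEnd ℂ) s * p‖ ≤ 2 := by
      refine (norm_sub_le _ _).trans ?_
      rw [norm_mul, Complex.norm_conj, norm_one]
      nlinarith [norm_nonneg s, norm_nonneg p]
    refine (sq_le_sq₀ (norm_nonneg _) (by positivity)).1 ?_
    rw [mul_pow, Real.sq_sqrt hQ.le]
    have h4 : ‖1 - (starRingEnd ℂ) s * p‖ ^ 2 ≤ 4 := by nlinarith [norm_nonneg (1 - (starRingEnd ℂ) s * p)]
    have : (1 - σ) * (1 - σ) ≤ (1 - ‖p‖ ^ 2) * (1 - ‖s‖ ^ 2) := by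
      apply mul_le_mul <;> nlinarith
    nlinarith [sq_nonneg (1 - σ)]

/-- Zero near `k`. -/
lemma zero_near (f : ℂ → ℂ) (hf : Differentiable ℂ f) (k : ℕ)
    (h : ∀ z : ℂ, ‖z‖ ≤ 1 / 4 → ‖f (z + (k : ℂ)) - z‖ < 1 / 16) :
    ∃ ζ : ℂ, ‖ζ - k‖ ≤ 1 / 4 ∧ f ζ = 0 := by
  by_contra! hne
  have hd : DiffContOnCl ℂ (fun z => (f (z + (k : ℂ)))⁻¹) (Metric.ball (0:ℂ) (1 / 4)) := by
    have : DifferentiableOn ℂ (fun z => (f (z + (k : ℂ)))⁻¹) (Metric.closedBall (0:ℂ) (1 / 4)) := by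
      apply DifferentiableOn.inv
      · exact (hf.comp (by fun_prop)).differentiableOn
      · intro z hz
        exact hne _ (by simpa using hz)
    apply DifferentiableOn.diffContOnCl
    rw [closure_ball _ (by norm_num)]
    exact this
  have h0 := h 0 (by norm_num)
  have hk : f k ≠ 0 := hne k (by norm_num)
  have := Complex.norm_le_of_forall_mem_frontier_norm_le (z := 0) (C := 8) Metric.isBounded_ball hd ?_
    (subset_closure (by simp))
  · simp only [zero_add, norm_inv, sub_zero] at this h0
    have h3 : 0 < ‖f k‖ := norm_pos_iff.2 hk
    rw [inv_le_comm₀ h3 (by norm_num)] at this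
    linarith
  · intro z hz
    rw [frontier_ball _ (by norm_num)] at hz
    have hz : ‖z‖ = 1 / 4 := by simpa using hz
    have h5 := h z hz.le
    have h6 : ‖z‖ ≤ ‖f (z + k)‖ + ‖f (z + k) - z‖ := by
      have := norm_sub_le (f (z + k)) (f (z + k) - z)
      simpa using this
    rw [norm_inv, inv_le_comm₀ (by linarith) (by norm_num)]
    linarith

open Bornology in
/-- Phragmen–Lindelöf in a quadrant with subexponential growth. -/
lemma quadrant_growth (G : ℂ → ℂ) (hG : Differentiable ℂ G) (C₀ τ : ℝ)
    (hexp : ∀ z, ‖G z‖ ≤ C₀ * Real.exp (τ * ‖z‖)) (C δ : ℝ) (hC : 0 ≤ C) (hδ : 0 ≤ δ)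
    (h1 : ∀ x : ℝ, 0 ≤ x → ‖G x‖ ≤ C * Real.exp (δ * x))
    (h2 : ∀ x : ℝ, 0 ≤ x → ‖G (x * I)‖ ≤ C * Real.exp (δ * x))
    (z : ℂ) (hre : 0 ≤ z.re) (him : 0 ≤ z.im) : ‖G z‖ ≤ C * Real.exp (2 * δ * ‖z‖) := by
  have hC0 : 0 ≤ C₀ := by
    have := (norm_nonneg _).trans (hexp 0)
    simpa using this
  have hnorm : ∀ w : ℂ, ‖G w * Complex.exp (-(δ : ℂ) * (1 - I) * w)‖
      = ‖G w‖ * Real.exp (-δ * (w.re + w.im)) := by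
    intro w
    rw [norm_mul, Complex.norm_exp]
    congr 2
    simp
    ring
  have := PhragmenLindelof.quadrant_I (f := fun w => G w * Complex.exp (-(δ : ℂ) * (1 - I) * w))
    (C := C) (z := z) ?_ ?_ ?_ ?_ hre him
  · rw [hnorm] at this
    have hthis := this
    have h3 : ‖G z‖ = ‖G z‖ * Real.exp (-δ * (z.re + z.im)) * Real.exp (δ * (z.re + z.im)) := by
      rw [mul_assoc, ← Real.exp_add]; simp
    rw [h3]
    have := (le_abs_self _).trans (Complex.abs_re_le_norm z)
    have := (le_abs_self _).trans (Complex.abs_im_le_norm z)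
    refine mul_le_mul hthis (Real.exp_le_exp.2 ?_) (Real.exp_pos _).le hC
    nlinarith
  · apply Differentiable.diffContOnCl
    fun_prop
  · refine ⟨1, by norm_num, τ + 2 * δ, ?_⟩
    refine Asymptotics.IsBigO.of_bound C₀ (Eventually.of_forall fun w => ?_)
    rw [hnorm, Real.norm_eq_abs, Real.abs_exp, Real.rpow_one, add_mul, Real.exp_add, ← mul_assoc]
    have := (neg_le_abs _).trans (Complex.abs_re_le_norm w)
    have := (neg_le_abs _).trans (Complex.abs_im_le_norm w)
    refine mul_le_mul (hexp w) (Real.exp_le_exp.2 ?_) (Real.exp_pos _).le (by positivity)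
    nlinarith
  · intro x hx
    rw [hnorm]
    have := h1 x hx
    calc _ ≤ C * Real.exp (δ * x) * Real.exp (-δ * ((x : ℂ).re + (x : ℂ).im)) := by gcongr
      _ = C := by rw [mul_assoc, ← Real.exp_add]; simp
  · intro x hx
    rw [hnorm]
    have := h2 x hx
    calc _ ≤ C * Real.exp (δ * x) * Real.exp (-δ * ((x * I : ℂ).re + (x * I : ℂ).im)) := by gcongr
      _ = C := by rw [mul_assoc, ← Real.exp_add]; simp

lemma halfplane_growth (G : ℂ → ℂ) (hG : Differentiable ℂ G) (C₀ τ : ℝ)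
    (hexp : ∀ z, ‖G z‖ ≤ C₀ * Real.exp (τ * ‖z‖)) (C δ : ℝ) (hC : 0 ≤ C) (hδ : 0 ≤ δ)
    (h1 : ∀ x : ℝ, 0 ≤ x → ‖G x‖ ≤ C * Real.exp (δ * x))
    (h2 : ∀ x : ℝ, 0 ≤ x → ‖G (x * I)‖ ≤ C * Real.exp (δ * x))
    (h3 : ∀ x : ℝ, 0 ≤ x → ‖G (-x)‖ ≤ C * Real.exp (δ * x))
    (z : ℂ) (him : 0 ≤ z.im) : ‖G z‖ ≤ C * Real.exp (2 * δ * ‖z‖) := by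
  rcases le_total 0 z.re with hre | hre
  · exact quadrant_growth G hG C₀ τ hexp C δ hC hδ h1 h2 z hre him
  · have := quadrant_growth (fun w => G (w * I)) (hG.comp (by fun_prop)) C₀ τ
      (fun w => by simpa using hexp (w * I)) C δ hC hδ h2
      (fun x hx => by
        have := h3 x hx
        rwa [mul_assoc, Complex.I_mul_I, mul_neg_one]) (z * (-I)) (by simpa using him)
        (by simpa using hre)
    simpa [mul_assoc] using this

/-- Boundedness above of the quotient defining the indicator. -/
lemma indicator_bdd (f : ℂ → ℂ) (hf : ExpType f) (θ : ℝ) :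
    IsBoundedUnder (· ≤ ·) atTop
      (fun r : ℝ => Real.log ‖f ((r : ℂ) * Complex.exp (θ * Complex.I))‖ / r) := by
  obtain ⟨-, C, τ, h⟩ := hf
  refine ⟨|C| + |τ|, ?_⟩
  rw [eventually_map]
  filter_upwards [eventually_ge_atTop 1] with r hr
  have hr0 : 0 < r := by linarith
  rw [div_le_iff₀ hr0]
  rcases eq_or_lt_of_le (norm_nonneg (f ((r : ℂ) * Complex.exp (θ * Complex.I)))) with h0 | h0
  · rw [← h0, Real.log_zero]; positivity
  · have h1 := h ((r : ℂ) * Complex.exp (θ * Complex.I))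
    rw [norm_mul, Complex.norm_exp_ofReal_mul_I, mul_one, Complex.norm_real, Real.norm_eq_abs,
      abs_of_pos hr0] at h1
    rw [Real.log_le_iff_le_exp h0]
    refine h1.trans ?_
    have h2 : C ≤ Real.exp |C| := by
      have := Real.add_one_le_exp |C|
      linarith [le_abs_self C]
    calc C * Real.exp (τ * r) ≤ Real.exp |C| * Real.exp (τ * r) := by gcongr
      _ = Real.exp (|C| + τ * r) := by rw [Real.exp_add]
      _ ≤ _ := by
        apply Real.exp_le_exp.2
        nlinarith [abs_nonneg C, le_abs_self τ]

lemma indicator_upper (f : ℂ → ℂ) (hf : ExpType f) (θ c : ℝ) (h : indicatorFn f θ < c) :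
    ∃ K : ℝ, 0 ≤ K ∧ ∀ r : ℝ, 0 ≤ r →
      ‖f ((r : ℂ) * Complex.exp (θ * Complex.I))‖ ≤ K * Real.exp (c * r) := by
  have h1 := eventually_lt_of_limsup_lt h (indicator_bdd f hf θ)
  obtain ⟨R, hR⟩ := eventually_atTop.1 h1
  have hcont : Continuous fun r : ℝ =>
      ‖f ((r : ℂ) * Complex.exp (θ * Complex.I))‖ * Real.exp (-(c * r)) := by
    have := hf.1.continuous
    fun_prop
  obtain ⟨K, hK⟩ := (isCompact_Icc (a := 0) (b := max R 1)).bddAbove_image hcont.continuousOn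
  refine ⟨max K 1, by positivity, fun r hr => ?_⟩
  rcases le_total r (max R 1) with hle | hle
  · have := hK (Set.mem_image_of_mem _ ⟨hr, hle⟩)
    simp only [Real.exp_neg] at this
    rw [← div_eq_mul_inv, div_le_iff₀ (Real.exp_pos _)] at this
    refine this.trans ?_
    gcongr
    exact le_max_left _ _
  · have hr1 : 1 ≤ r := (le_max_right _ _).trans hle
    have := hR r ((le_max_left _ _).trans hle)
    rw [div_lt_iff₀ (by linarith)] at this
    have h2 : ‖f ((r : ℂ) * Complex.exp (θ * Complex.I))‖ ≤ Real.exp (c * r) := by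
      rcases eq_or_lt_of_le (norm_nonneg (f ((r : ℂ) * Complex.exp (θ * Complex.I)))) with h0 | h0
      · rw [← h0]; positivity
      · exact (Real.log_le_iff_le_exp h0).1 this.le
    refine h2.trans ?_
    exact le_mul_of_one_le_left (Real.exp_pos _).le (le_max_right _ _)

lemma indicator_lower (f : ℂ → ℂ) (c : ℝ) (hc : 0 ≤ c) (h : c < indicatorFn f 0) :
    ∃ᶠ r : ℝ in atTop, Real.exp (c * r) ≤ ‖f r‖ := by
  have h1 : ∃ᶠ r : ℝ in atTop, c < Real.log ‖f ((r : ℂ) * Complex.exp ((0 : ℝ) * Complex.I))‖ / r := by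
    by_contra hcon
    rw [not_frequently] at hcon
    unfold indicatorFn at h
    rw [limsup_eq] at h
    set S := {a : ℝ | ∀ᶠ (n : ℝ) in atTop,
      Real.log ‖f ((n : ℂ) * Complex.exp ((0 : ℝ) * Complex.I))‖ / n ≤ a} with hS
    have hcS : c ∈ S := by
      filter_upwards [hcon] with r hr using not_lt.1 hr
    by_cases hb : BddBelow S
    · exact absurd (csInf_le hb hcS) (not_le.2 h)
    · rw [Real.sInf_of_not_bddBelow hb] at h
      linarith
  refine (h1.and_eventually (eventually_ge_atTop 1)).mono fun r hr => ?_
  obtain ⟨h2, h3⟩ := hr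
  rw [lt_div_iff₀ (by linarith)] at h2
  simp only [Complex.ofReal_zero, zero_mul, Complex.exp_zero, mul_one] at h2
  rcases eq_or_lt_of_le (norm_nonneg (f r)) with h0 | h0
  · rw [← h0, Real.log_zero] at h2
    nlinarith
  · exact (Real.le_log_iff_exp_le h0).1 h2.le

open scoped Classical in
lemma density_count (A : Set ℕ) (hA : 0 < lowerDensity A) :
    ∃ d η : ℝ, 0 < d ∧ 0 < η ∧ η ≤ 1 ∧ ∀ᶠ r : ℝ in atTop,
      ∃ S : Finset ℕ, (∀ n ∈ S, n ∈ A ∧ η * r ≤ n ∧ (n : ℝ) ≤ r) ∧ d * r ≤ S.card := by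
  unfold lowerDensity at hA
  obtain ⟨D, hD0, hD⟩ := exists_between hA
  have hev := eventually_lt_of_lt_liminf hD ⟨0, by
    rw [eventually_map]
    exact Eventually.of_forall fun n => by positivity⟩
  refine ⟨D / 4, min (D / 4) 1, by positivity, by positivity, min_le_right _ _, ?_⟩
  filter_upwards [tendsto_nat_floor_atTop.eventually hev, eventually_ge_atTop 1,
    eventually_ge_atTop ((D + 1) / (D / 2))] with r hr hr1 hr2
  set η := min (D / 4) 1 with hη
  have hηD : η ≤ D / 4 := min_le_left _ _
  have hη0 : 0 < η := by positivity
  set N := ⌊r⌋₊ with hN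
  have hN1 : (1 : ℝ) ≤ N := by
    have : 1 ≤ N := Nat.le_floor (by simpa using hr1)
    exact_mod_cast this
  have hNr : (N : ℝ) ≤ r := Nat.floor_le (by linarith)
  have hNr2 : r < N + 1 := Nat.lt_floor_add_one r
  rw [lt_div_iff₀ (by linarith)] at hr
  set T := (Finset.range (N + 1)).filter (fun n => n ∈ A) with hT
  refine ⟨T.filter (fun n => η * r ≤ n), ?_, ?_⟩
  · intro n hn
    simp only [hT, Finset.mem_filter, Finset.mem_range] at hn
    refine ⟨hn.1.2, hn.2, ?_⟩
    have : (n : ℝ) ≤ N := by exact_mod_cast Nat.lt_succ_iff.1 hn.1.1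
    linarith
  · have h1 := Finset.card_filter_add_card_filter_not (s := T) (fun n : ℕ => η * r ≤ n)
    have h2 : (T.filter (fun n : ℕ => ¬ η * r ≤ n)).card ≤ ⌊η * r⌋₊ + 1 := by
      rw [← Finset.card_range (⌊η * r⌋₊ + 1)]
      apply Finset.card_le_card
      intro n hn
      simp only [Finset.mem_filter, not_le, Finset.mem_range] at hn ⊢
      have := Nat.le_floor hn.2.le
      omega
    have h3 : (⌊η * r⌋₊ : ℝ) ≤ η * r := Nat.floor_le (by positivity)
    have h4 : ((T.filter (fun n : ℕ => η * r ≤ n)).card : ℝ)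
      + (T.filter (fun n : ℕ => ¬ η * r ≤ n)).card = T.card := by exact_mod_cast h1
    have h5 : ((T.filter (fun n : ℕ => ¬ η * r ≤ n)).card : ℝ) ≤ ⌊η * r⌋₊ + 1 := by exact_mod_cast h2
    rw [div_le_iff₀ (by positivity)] at hr2
    nlinarith

/-- The core estimate: a function of zero exponential type in the upper half plane which
vanishes at many points near the ray of direction `e^{iε}` is small on this ray. -/
lemma core_estimate (ε : ℝ) (hs : 0 < Real.sin ε) (d η : ℝ) (hd : 0 < d) (hη : 0 < η)
    (hη1 : η ≤ 1) :
    ∃ lam M r₀ : ℝ, 0 < lam ∧ 0 < M ∧ 1 ≤ r₀ ∧ ∀ (F : ℂ → ℂ), Differentiable ℂ F →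
      ∀ (C δ : ℝ), 0 ≤ δ → (∀ w : ℂ, 0 ≤ w.im → ‖F w‖ ≤ C * Real.exp (δ * ‖w‖)) →
      ∀ r : ℝ, r₀ ≤ r → ∀ (S : Finset ℕ) (Z : ℕ → ℂ),
      (∀ n ∈ S, η * r ≤ n ∧ (n : ℝ) ≤ r) → (d * r ≤ S.card) →
      (∀ n ∈ S, ‖Z n - n‖ ≤ 1 / 4 ∧ F (Z n * Complex.exp (ε * I)) = 0) →
      ‖F (r * Complex.exp (ε * I))‖ ≤ C * Real.exp (2 * M * δ * r) * Real.exp (-lam * r) := by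
  classical
  have hs1 : Real.sin ε ≤ 1 := Real.sin_le_one ε
  obtain ⟨M, hM⟩ : ∃ M : ℝ, M = 2 / Real.sin ε := ⟨_, rfl⟩
  have hMs : M * Real.sin ε = 2 := by rw [hM]; field_simp
  have hM2 : 2 ≤ M := by rw [hM, le_div_iff₀ hs]; linarith
  have hM0 : 0 < M := by linarith
  have hσ : 0 ≤ 1 - η / M ^ 2 := by
    rw [sub_nonneg, div_le_one (by positivity)]; nlinarith
  obtain ⟨q, hq0, hq1, hq⟩ := pseudo_bound (1 - η / M ^ 2) hσ (by
    have : 0 < η / M ^ 2 := by positivity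
    linarith)
  have hlogq : Real.log q < 0 := Real.log_neg hq0 hq1
  refine ⟨-Real.log q * d, M, max 1 (M / η), by nlinarith, hM0, le_max_left _ _, ?_⟩
  intro F hF C δ hδ hFb r hr S Z hS hcard hZ
  have hr1 : 1 ≤ r := (le_max_left _ _).trans hr
  have hr0 : 0 < r := by linarith
  have hr2 : M ≤ η * r := by
    have := (le_max_right _ _).trans hr
    rw [div_le_iff₀ hη] at this; linarith
  have hC0 : 0 ≤ C := by
    have := (norm_nonneg _).trans (hFb 0 (by simp))
    simpa using this
  -- the normalisation
  set e := Complex.exp (ε * I) with he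
  have hen : ‖e‖ = 1 := Complex.norm_exp_ofReal_mul_I ε
  have heim : e.im = Real.sin ε := Complex.exp_ofReal_mul_I_im ε
  have hMr : ((M * r : ℝ) : ℂ) ≠ 0 := by exact_mod_cast (by positivity : M * r ≠ 0)
  let nm : ℂ → ℂ := fun w => (w - (M * r : ℝ) * I) / (M * r : ℝ)
  let dn : ℂ → ℂ := fun u => (M * r : ℝ) * I + (M * r : ℝ) * u
  have hdn : ∀ w, dn (nm w) = w := by
    intro w
    simp only [dn, nm]
    field_simp
    ring
  have hnmsq : ∀ w : ℂ, ‖w‖ ^ 2 - 2 * (M * r) * w.im ≤ - (η * r ^ 2) →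
      ‖nm w‖ ^ 2 ≤ 1 - η / M ^ 2 := by
    intro w hw
    have h1 : ‖w - (M * r : ℝ) * I‖ ^ 2 = ‖w‖ ^ 2 - 2 * (M * r) * w.im + (M * r) ^ 2 := by
      simp only [← Complex.normSq_eq_norm_sq, Complex.normSq_apply]
      simp
      ring
    simp only [nm]
    rw [norm_div, div_pow, h1, Complex.norm_real, Real.norm_eq_abs, sq_abs,
      div_le_iff₀ (by positivity)]
    have : (1 - η / M ^ 2) * (M * r) ^ 2 = (M * r) ^ 2 - η * r ^ 2 := by field_simp
    rw [this]; linarith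
  have hlt1 : ∀ u : ℂ, ‖u‖ ^ 2 ≤ 1 - η / M ^ 2 → ‖u‖ < 1 := by
    intro u hu
    have : 0 < η / M ^ 2 := by positivity
    nlinarith [norm_nonneg u]
  have hp : ‖nm (r * e)‖ ^ 2 ≤ 1 - η / M ^ 2 := by
    apply hnmsq
    rw [norm_mul, hen, Complex.norm_real, Real.norm_eq_abs, mul_one, sq_abs, Complex.im_ofReal_mul, heim]
    have : 2 * (M * r) * (r * Real.sin ε) = 4 * r ^ 2 := by
      linear_combination (2 * r ^ 2) * hMs
    rw [this]; nlinarith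
  have hz : ∀ n ∈ S, ‖nm (Z n * e)‖ ^ 2 ≤ 1 - η / M ^ 2 := by
    intro n hn
    apply hnmsq
    obtain ⟨h1, h2⟩ := hS n hn
    obtain ⟨h3, -⟩ := hZ n hn
    have h4 : ‖Z n * e‖ ≤ n + 1 / 4 := by
      rw [norm_mul, hen, mul_one]
      calc ‖Z n‖ = ‖(n : ℂ) + (Z n - n)‖ := by ring_nf
        _ ≤ ‖(n : ℂ)‖ + ‖Z n - n‖ := norm_add_le _ _
        _ ≤ _ := by rw [Complex.norm_natCast]; linarith
    have h5 : n * Real.sin ε - 1 / 4 ≤ (Z n * e).im := by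
      have h6 : Z n * e = (n : ℝ) * e + (Z n - n) * e := by push_cast; ring
      have h7 : -((Z n - n) * e).im ≤ 1 / 4 := by
        refine (neg_le_abs _).trans ((Complex.abs_im_le_norm _).trans ?_)
        rwa [norm_mul, hen, mul_one]
      rw [h6, Complex.add_im, Complex.im_ofReal_mul, heim]
      linarith
    have hn2 : (2 : ℝ) ≤ n := by linarith
    have h8 : ‖Z n * e‖ ^ 2 ≤ 2 * n * r := by
      have : ‖Z n * e‖ ^ 2 ≤ (n + 1 / 4) ^ 2 := by gcongr
      nlinarith
    have h9 : 2 * (M * r) * (n * Real.sin ε - 1 / 4) ≤ 2 * (M * r) * (Z n * e).im := by gcongr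
    have h10 : 2 * (M * r) * (n * Real.sin ε - 1 / 4) = 4 * r * n - M * r / 2 := by
      linear_combination (2 * r * n) * hMs
    have h11 : M * r ≤ n * r := by gcongr; linarith
    have h12 : η * r * r ≤ n * r := by gcongr
    nlinarith
  have hinj : Set.InjOn (fun n => nm (Z n * e)) S := by
    intro n hn m hm hnm
    have h1 : Z n * e = Z m * e := by
      have := congrArg dn hnm
      simpa only [hdn] using this
    have h2 : Z n = Z m := mul_right_cancel₀ (Complex.exp_ne_zero _) h1
    have h3 := (hZ n hn).1
    have h4 := (hZ m hm).1
    have h5 : ‖((n : ℝ) - (m : ℝ) : ℝ)‖ ≤ 1 / 2 := by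
      rw [← Complex.norm_real]
      calc ‖(((n : ℝ) - (m : ℝ) : ℝ) : ℂ)‖ = ‖(Z m - m) - (Z n - n)‖ := by
            rw [h2]; push_cast; ring_nf
        _ ≤ ‖Z m - m‖ + ‖Z n - n‖ := norm_sub_le _ _
        _ ≤ _ := by linarith
    rw [Real.norm_eq_abs, abs_le] at h5
    have h6 : (n : ℝ) < m + 1 := by linarith
    have h7 : (m : ℝ) < n + 1 := by linarith
    have h8 : n < m + 1 := by exact_mod_cast h6
    have h9 : m < n + 1 := by exact_mod_cast h7
    omega
  have key := blaschke_bound (S.image (fun n => nm (Z n * e))) (fun u => F (dn u))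
    (hF.comp (by simp only [dn]; fun_prop)) (C * Real.exp (2 * M * δ * r)) q hq0.le
    ?_ ?_ ?_ (nm (r * e)) (hlt1 _ hp) ?_
  · simp only [hdn] at key
    rw [Finset.card_image_of_injOn hinj] at key
    refine key.trans ?_
    gcongr
    rw [← Real.exp_log (pow_pos hq0 S.card), Real.log_pow]
    apply Real.exp_le_exp.2
    nlinarith
  · intro u hu
    have h1 : |u.im| ≤ 1 := hu ▸ Complex.abs_im_le_norm u
    have h2 : 0 ≤ (dn u).im := by
      have : (dn u).im = M * r * (1 + u.im) := by
        simp only [dn, Complex.add_im, Complex.im_ofReal_mul, Complex.I_im]; ring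
      rw [this]
      have := (abs_le.1 h1).1
      have h3 : 0 ≤ 1 + u.im := by linarith
      positivity
    have h3 : ‖dn u‖ ≤ 2 * M * r := by
      refine (norm_add_le _ _).trans ?_
      rw [norm_mul, norm_mul, hu, Complex.norm_I, Complex.norm_real, Real.norm_eq_abs,
        abs_of_pos (by positivity)]
      linarith
    refine (hFb _ h2).trans (mul_le_mul_of_nonneg_left (Real.exp_le_exp.2 ?_) hC0)
    nlinarith
  · intro s hs
    obtain ⟨n, hn, rfl⟩ := Finset.mem_image.1 hs
    simp only [hdn]
    exact (hZ n hn).2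
  · intro s hs
    obtain ⟨n, hn, rfl⟩ := Finset.mem_image.1 hs
    exact hlt1 _ (hz n hn)
  · intro s hs
    obtain ⟨n, hn, rfl⟩ := Finset.mem_image.1 hs
    exact hq _ _ hp (hz n hn)

/-- **Remark 3.** For `a > 0`, `b ∈ ℝ`, `0 < ε < π` there is no frequently
Birkhoff-universal entire function `f` of exponential type with
`h_f(θ) = −b sin θ + a |sin (θ + ε)|` on `[−π, π]`. -/
theorem stmt9 (a b ε : ℝ) (ha : 0 < a) (hε0 : 0 < ε) (hεπ : ε < Real.pi) :
    ¬ ∃ f : ℂ → ℂ, ExpType f ∧ FHCEnt f ∧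
      ∀ θ ∈ Set.Icc (-Real.pi) Real.pi,
        indicatorFn f θ = -b * Real.sin θ + a * |Real.sin (θ + ε)| := by
  rintro ⟨f, hf, hfhc, hind⟩
  have hs : 0 < Real.sin ε := Real.sin_pos_of_pos_of_lt_pi hε0 hεπ
  -- zeros of f
  set A : Set ℕ := {k : ℕ | ∀ z : ℂ, ‖z‖ ≤ 1 / 4 → ‖f (z + (k : ℂ)) - z‖ < 1 / 16} with hA
  have hdens : 0 < lowerDensity A :=
    hfhc.2 (fun z => z) differentiable_id (1 / 4) (by norm_num) (1 / 16) (by norm_num)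
  have hzero : ∀ k : ℕ, ∃ ζ : ℂ, k ∈ A → ‖ζ - k‖ ≤ 1 / 4 ∧ f ζ = 0 := by
    intro k
    by_cases hk : k ∈ A
    · obtain ⟨ζ, h⟩ := zero_near f hf.1 k hk
      exact ⟨ζ, fun _ => h⟩
    · exact ⟨0, fun h => absurd h hk⟩
  choose Z hZ using hzero
  obtain ⟨d, η, hd, hη, hη1, hcount⟩ := density_count A hdens
  obtain ⟨lam, M, r₀, hlam, hM, hr₀, hcore⟩ := core_estimate ε hs d η hd hη hη1
  obtain ⟨C₀, τ, hexp⟩ := hf.2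
  have hC₀ : 0 ≤ C₀ := by
    have := (norm_nonneg _).trans (hexp 0)
    simpa using this
  -- the auxiliary function
  set κ : ℂ := ⟨b * Real.sin ε, b * Real.cos ε - a⟩ with hκ
  set F : ℂ → ℂ := fun w => f (w * Complex.exp (-(ε : ℂ) * I)) * Complex.exp (-κ * w) with hF
  have hFd : Differentiable ℂ F := by
    have h1 := hf.1
    have h2 : Differentiable ℂ fun w => f (w * Complex.exp (-(ε : ℂ) * I)) :=
      h1.comp (by fun_prop)
    exact h2.mul (by fun_prop)
  have hen : ‖Complex.exp (-(ε : ℂ) * I)‖ = 1 := by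
    have := Complex.norm_exp_ofReal_mul_I (-ε)
    simpa using this
  have hFexp : ∀ w, ‖F w‖ ≤ C₀ * Real.exp ((τ + ‖κ‖) * ‖w‖) := by
    intro w
    simp only [hF]
    rw [norm_mul, add_mul, Real.exp_add, ← mul_assoc]
    have h1 := hexp (w * Complex.exp (-(ε : ℂ) * I))
    rw [norm_mul, hen, mul_one] at h1
    have h2 : ‖Complex.exp (-κ * w)‖ ≤ Real.exp (‖κ‖ * ‖w‖) := by
      rw [Complex.norm_exp]
      apply Real.exp_le_exp.2
      refine (Complex.re_le_norm _).trans ?_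
      rw [norm_mul, norm_neg]
    exact mul_le_mul h1 h2 (norm_nonneg _) (by positivity)
  have hFray : ∀ (r φ : ℝ), ‖F (r * Complex.exp (φ * I))‖ =
      ‖f (r * Complex.exp (((φ - ε : ℝ) : ℂ) * I))‖ *
        Real.exp (-((-b * Real.sin (φ - ε) + a * Real.sin φ) * r)) := by
    intro r φ
    simp only [hF]
    rw [norm_mul, mul_assoc (r : ℂ), ← Complex.exp_add, Complex.norm_exp]
    congr 2
    · congr 3
      push_cast
      ring
    · rw [neg_mul, Complex.neg_re, mul_left_comm, Complex.re_ofReal_mul, Complex.mul_re,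
        Complex.exp_ofReal_mul_I_re, Complex.exp_ofReal_mul_I_im, Real.sin_sub]
      simp only [hκ]
      ring
  have hax : ∀ δ > 0, ∀ φ : ℝ, 0 ≤ φ → φ ≤ Real.pi → ∃ K : ℝ, 0 ≤ K ∧ ∀ r : ℝ, 0 ≤ r →
      ‖F (r * Complex.exp (φ * I))‖ ≤ K * Real.exp (δ * r) := by
    intro δ hδ φ h0 h1
    have hi := hind (φ - ε) ⟨by linarith, by linarith⟩
    rw [sub_add_cancel, abs_of_nonneg (Real.sin_nonneg_of_nonneg_of_le_pi h0 h1)] at hi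
    obtain ⟨K, hK0, hK⟩ := indicator_upper f hf (φ - ε)
      (-b * Real.sin (φ - ε) + a * Real.sin φ + δ) (by rw [hi]; linarith)
    refine ⟨K, hK0, fun r hr => ?_⟩
    rw [hFray]
    calc _ ≤ K * Real.exp ((-b * Real.sin (φ - ε) + a * Real.sin φ + δ) * r) *
          Real.exp (-((-b * Real.sin (φ - ε) + a * Real.sin φ) * r)) := by
          gcongr
          exact hK r hr
      _ = _ := by
        rw [mul_assoc, ← Real.exp_add]
        congr 2
        ring
  have hhalf : ∀ δ > 0, ∃ C : ℝ, 0 ≤ C ∧ ∀ w : ℂ, 0 ≤ w.im →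
      ‖F w‖ ≤ C * Real.exp (2 * δ * ‖w‖) := by
    intro δ hδ
    obtain ⟨K₁, hK₁, h1⟩ := hax δ hδ 0 le_rfl Real.pi_pos.le
    obtain ⟨K₂, hK₂, h2⟩ := hax δ hδ (Real.pi / 2) (by positivity) (by linarith [Real.pi_pos])
    obtain ⟨K₃, hK₃, h3⟩ := hax δ hδ Real.pi Real.pi_pos.le le_rfl
    refine ⟨K₁ + K₂ + K₃, by positivity, ?_⟩
    refine halfplane_growth F hFd C₀ _ hFexp (K₁ + K₂ + K₃) δ (by positivity) hδ.le ?_ ?_ ?_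
    · intro x hx
      have h := h1 x hx
      simp only [Complex.ofReal_zero, zero_mul, Complex.exp_zero, mul_one] at h
      exact h.trans (by gcongr; linarith)
    · intro x hx
      have h := h2 x hx
      push_cast at h
      rw [Complex.exp_pi_div_two_mul_I] at h
      exact h.trans (by gcongr; linarith)
    · intro x hx
      have h := h3 x hx
      rw [Complex.exp_pi_mul_I, mul_neg_one] at h
      exact h.trans (by gcongr; linarith)
  -- choice of δ
  have hi0 : indicatorFn f 0 = a * Real.sin ε := by
    rw [hind 0 ⟨by linarith [Real.pi_pos], Real.pi_pos.le⟩]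
    simp [abs_of_pos hs]
  have has : 0 < a * Real.sin ε := by positivity
  obtain ⟨δ, hδ, hδ1, hδ2⟩ : ∃ δ : ℝ, 0 < δ ∧ δ ≤ a * Real.sin ε ∧ (4 * M + 1) * δ ≤ lam / 2 := by
    refine ⟨min (a * Real.sin ε) (lam / 2 / (4 * M + 1)), by positivity, min_le_left _ _, ?_⟩
    have h := min_le_right (a * Real.sin ε) (lam / 2 / (4 * M + 1))
    rw [le_div_iff₀ (by positivity)] at h
    linarith
  obtain ⟨C, hC, hFC⟩ := hhalf δ hδ
  have hlow := indicator_lower f (a * Real.sin ε - δ) (by linarith) (by rw [hi0]; linarith)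
  have htend : ∀ᶠ r : ℝ in atTop, C * Real.exp (-(lam / 2) * r) < 1 := by
    have h1 : Tendsto (fun r : ℝ => C * Real.exp (-(lam / 2) * r)) atTop (nhds (C * 0)) := by
      refine Tendsto.const_mul _ (Real.tendsto_exp_atBot.comp ?_)
      exact tendsto_id.const_mul_atTop_of_neg (by linarith)
    rw [mul_zero] at h1
    exact h1.eventually (gt_mem_nhds one_pos)
  obtain ⟨r, hr, hr1, hr2, S, hS, hScard⟩ := (hlow.and_eventually
    (htend.and ((eventually_ge_atTop r₀).and hcount))).exists
  have hr0 : 0 < r := by linarith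
  have hmain := hcore F hFd C (2 * δ) (by positivity) hFC r hr2 S Z
    (fun n hn => (hS n hn).2) hScard (fun n hn => by
      obtain ⟨h1, h2⟩ := hZ n (hS n hn).1
      refine ⟨h1, ?_⟩
      simp only [hF]
      rw [mul_assoc, ← Complex.exp_add]
      simp [h2])
  rw [hFray] at hmain
  simp only [sub_self, Complex.ofReal_zero, zero_mul, Complex.exp_zero, mul_one, Real.sin_zero,
    mul_zero, zero_add] at hmain
  have h1 : Real.exp (-δ * r) ≤ C * Real.exp (2 * M * (2 * δ) * r) * Real.exp (-lam * r) := by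
    refine le_trans ?_ hmain
    calc Real.exp (-δ * r) = Real.exp ((a * Real.sin ε - δ) * r) *
          Real.exp (-(a * Real.sin ε * r)) := by rw [← Real.exp_add]; congr 1; ring
      _ ≤ _ := by gcongr
  have h2 : C * Real.exp (2 * M * (2 * δ) * r) * Real.exp (-lam * r) ≤
      C * Real.exp (-(lam / 2) * r) * Real.exp (-δ * r) := by
    rw [mul_assoc C, mul_assoc C, ← Real.exp_add, ← Real.exp_add]
    refine mul_le_mul_of_nonneg_left (Real.exp_le_exp.2 ?_) hC
    nlinarith
  have h3 := Real.exp_pos (-δ * r)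
  nlinarith
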